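/- Flatness of an algebra is flat-local: let A be a commutative semiring, B a commutative A-algebra, and (C_i)_{i ∈ ι} a faithful family of flat commutative B-algebras, where each C_i is also an A-algebra compatibly with the map A → B (scalar tower A → B → C_i). Then B is flat as an A-module if and only if every C_i is flat as an A-module. -/

import Mathlib

open TensorProduct

universe u

/-- A module `M` over a commutative semiring `R` is *flat* if for every pair of `R`-linear
maps `f g : N → P`, the map `M ⊗ E → M ⊗ N` induced by the inclusion of the equalizer
submodule `E = {x ∈ N | f x = g x}` is injective with range the equalizer of
`id_M ⊗ f` and `id_M ⊗ g`. -/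
def Module.IsSemiringFlat (R M : Type u) [CommSemiring R] [AddCommMonoid M]
    [Module R M] : Prop :=
  ∀ (N P : Type u) [AddCommMonoid N] [Module R N] [AddCommMonoid P] [Module R P]
    (f g : N →ₗ[R] P),
    Function.Injective (LinearMap.lTensor M (LinearMap.eqLocus f g).subtype) ∧
      LinearMap.range (LinearMap.lTensor M (LinearMap.eqLocus f g).subtype) =
        LinearMap.eqLocus (LinearMap.lTensor M f) (LinearMap.lTensor M g)

/-- A family `(C i)` of `R`-algebras is *faithful* if a map of `R`-modules is bijective
as soon as all the maps obtained by tensoring with the `C i` are bijective. -/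
def Algebra.IsFaithfulFamily (R : Type u) [CommSemiring R] {ι : Type u} (C : ι → Type u)
    [∀ i, CommSemiring (C i)] [∀ i, Algebra R (C i)] : Prop :=
  ∀ (M P : Type u) [AddCommMonoid M] [Module R M] [AddCommMonoid P] [Module R P]
    (g : M →ₗ[R] P),
    (∀ i, Function.Bijective (LinearMap.lTensor (C i) g)) → Function.Bijective g

/-- The map `j` is an equalizer of `f` and `g` in the category of types. -/
def Function.IsEqualizer {E N P : Type*} (j : E → N) (f g : N → P) : Prop :=
  Function.Injective j ∧ ∀ z, z ∈ Set.range j ↔ f z = g z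

namespace Function.IsEqualizer

variable {E E' N N' P P' : Type*} {j : E → N} {f g : N → P}

theorem comp_bijective (H : IsEqualizer j f g) {h : E' → E} (hh : Bijective h) :
    IsEqualizer (j ∘ h) f g :=
  ⟨H.1.comp hh.1, by simpa only [hh.2.range_comp] using H.2⟩

theorem bijective_of_comp (H : IsEqualizer j f g) {h : E' → E}
    (H' : IsEqualizer (j ∘ h) f g) : Bijective h := by
  refine ⟨H'.1.of_comp, fun y => ?_⟩
  obtain ⟨x, hx⟩ := (H'.2 (j y)).2 ((H.2 (j y)).1 ⟨y, rfl⟩)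
  exact ⟨x, H.1 hx⟩

theorem iff_of_equiv {j' : E' → N'} {f' g' : N' → P'} (a : E ≃ E') (b : N ≃ N') (c : P ≃ P')
    (hj : ∀ x, b (j x) = j' (a x)) (hf : ∀ x, c (f x) = f' (b x))
    (hg : ∀ x, c (g x) = g' (b x)) : IsEqualizer j f g ↔ IsEqualizer j' f' g' := by
  have hj' : j' = b ∘ j ∘ a.symm := by ext x; simp [hj]
  refine and_congr ?_ ?_
  · simp [hj']
  · rw [← b.forall_congr_right]
    refine forall_congr' fun z => ?_
    rw [← hf, ← hg, c.injective.eq_iff, hj', Set.range_comp, a.symm.surjective.range_comp,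
      b.injective.mem_set_image]

end Function.IsEqualizer

theorem isEqualizer_coe_iff {R E N P : Type*} [CommSemiring R] [AddCommMonoid E] [Module R E]
    [AddCommMonoid N] [Module R N] [AddCommMonoid P] [Module R P]
    {j : E →ₗ[R] N} {f g : N →ₗ[R] P} :
    Function.IsEqualizer j f g ↔
      Function.Injective j ∧ LinearMap.range j = LinearMap.eqLocus f g :=
  and_congr_right fun _ =>
    (SetLike.ext_iff (p := LinearMap.range j) (q := LinearMap.eqLocus f g)).symm

theorem isEqualizer_eqLocus_subtype {R N P : Type*} [CommSemiring R]
    [AddCommMonoid N] [Module R N] [AddCommMonoid P] [Module R P] (f g : N →ₗ[R] P) :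
    Function.IsEqualizer (LinearMap.eqLocus f g).subtype f g :=
  isEqualizer_coe_iff.2 ⟨Subtype.val_injective, Submodule.range_subtype _⟩

/-- Tensoring with a flat module preserves all equalizers. -/
theorem Module.IsSemiringFlat.isEqualizer_lTensor {R M E N P : Type u} [CommSemiring R]
    [AddCommMonoid M] [Module R M] [AddCommMonoid E] [Module R E]
    [AddCommMonoid N] [Module R N] [AddCommMonoid P] [Module R P]
    (hM : Module.IsSemiringFlat R M) (j : E →ₗ[R] N) (f g : N →ₗ[R] P)
    (H : Function.IsEqualizer j f g) :
    Function.IsEqualizer (j.lTensor M) (f.lTensor M) (g.lTensor M) := by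
  let h : E →ₗ[R] LinearMap.eqLocus f g := j.codRestrict _ fun x => (H.2 (j x)).1 ⟨x, rfl⟩
  have hh : Function.Bijective h :=
    (isEqualizer_eqLocus_subtype f g).bijective_of_comp (h := h) H
  have hj : j = (LinearMap.eqLocus f g).subtype ∘ₗ (LinearEquiv.ofBijective h hh).toLinearMap :=
    rfl
  rw [hj, LinearMap.lTensor_comp]
  exact (isEqualizer_coe_iff.2 (hM N P f g)).comp_bijective
    (LinearEquiv.lTensor M (LinearEquiv.ofBijective h hh)).bijective

theorem cancelBaseChange_lTensor_baseChange {A B C N P : Type*} [CommSemiring A]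
    [CommSemiring B] [Algebra A B] [CommSemiring C] [Algebra B C] [Algebra A C]
    [IsScalarTower A B C] [AddCommMonoid N] [Module A N] [AddCommMonoid P] [Module A P]
    (f : N →ₗ[A] P) (x : C ⊗[B] (B ⊗[A] N)) :
    AlgebraTensorModule.cancelBaseChange A B B C P ((f.baseChange B).lTensor C x) =
      f.lTensor C (AlgebraTensorModule.cancelBaseChange A B B C N x) := by
  induction x with
  | zero => simp
  | add x y hx hy => simp only [map_add, hx, hy]
  | tmul c y =>
    induction y with
    | zero => simp
    | add x y hx hy => simp only [tmul_add, map_add, hx, hy]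
    | tmul b n => simp

theorem isEqualizer_lTensor_baseChange_iff {A B C E N P : Type*} [CommSemiring A]
    [CommSemiring B] [Algebra A B] [CommSemiring C] [Algebra B C] [Algebra A C]
    [IsScalarTower A B C] [AddCommMonoid E] [Module A E] [AddCommMonoid N] [Module A N]
    [AddCommMonoid P] [Module A P] {j : E →ₗ[A] N} {f g : N →ₗ[A] P} :
    Function.IsEqualizer ((j.baseChange B).lTensor C) ((f.baseChange B).lTensor C)
        ((g.baseChange B).lTensor C) ↔
      Function.IsEqualizer (j.lTensor C) (f.lTensor C) (g.lTensor C) :=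
  Function.IsEqualizer.iff_of_equiv
    (AlgebraTensorModule.cancelBaseChange A B B C E).toEquiv
    (AlgebraTensorModule.cancelBaseChange A B B C N).toEquiv
    (AlgebraTensorModule.cancelBaseChange A B B C P).toEquiv
    (cancelBaseChange_lTensor_baseChange j) (cancelBaseChange_lTensor_baseChange f)
    (cancelBaseChange_lTensor_baseChange g)

/-- Flatness of an algebra is flat-local: given a faithful family of flat `B`-algebras
`C i` (compatibly `A`-algebras), `B` is flat over `A` iff every `C i` is flat over `A`. -/
theorem algebra_flat_iff_of_faithful_flat_family (A B : Type u) [CommSemiring A]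
    [CommSemiring B] [Algebra A B]
    {ι : Type u} (C : ι → Type u) [∀ i, CommSemiring (C i)] [∀ i, Algebra B (C i)]
    [∀ i, Algebra A (C i)] [∀ i, IsScalarTower A B (C i)]
    (hfaith : Algebra.IsFaithfulFamily B C)
    (hflat : ∀ i, Module.IsSemiringFlat B (C i)) :
    Module.IsSemiringFlat A B ↔ ∀ i, Module.IsSemiringFlat A (C i) := by
  refine ⟨fun hB i N P _ _ _ _ f g => ?_, fun hC N P _ _ _ _ f g => ?_⟩
  · rw [← isEqualizer_coe_iff, ← isEqualizer_lTensor_baseChange_iff (B := B)]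
    refine (hflat i).isEqualizer_lTensor _ _ _ ?_
    exact hB.isEqualizer_lTensor _ f g (isEqualizer_eqLocus_subtype f g)
  · rw [← isEqualizer_coe_iff]
    let f' := f.baseChange B
    let g' := g.baseChange B
    let j' := (LinearMap.eqLocus f g).subtype.baseChange B
    have hj (x) : f' (j' x) = g' (j' x) := by
      induction x with
      | zero => simp
      | tmul b e => simp [f', g', j', show f e = g e from e.2]
      | add x y hx hy => simp only [map_add, hx, hy]
    let h := j'.codRestrict (LinearMap.eqLocus f' g') hj
    have hh : (LinearMap.eqLocus f' g').subtype ∘ₗ h = j' := rfl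
    have hbij : Function.Bijective h := by
      refine hfaith _ _ h fun i => ?_
      refine Function.IsEqualizer.bijective_of_comp
        ((hflat i).isEqualizer_lTensor _ f' g' (isEqualizer_eqLocus_subtype f' g')) ?_
      rw [← LinearMap.coe_comp, ← LinearMap.lTensor_comp, hh,
        isEqualizer_lTensor_baseChange_iff, isEqualizer_coe_iff]
      exact hC i N P f g
    exact (isEqualizer_eqLocus_subtype f' g').comp_bijective hbij
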